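/- Under the standing hypotheses (a seven-term arithmetic progression a, a+d, ..., a+6d in S with d ≥ 1 and 3^9 ≤ a+6d), the common difference satisfies d ≥ 500. -/

import Mathlib

theorem two_mul_pow_le_pow_of_lt {p x y : ℕ} (hp : 2 ≤ p) (h : p ^ x < p ^ y) :
    2 * p ^ x ≤ p ^ y := by
  have hxy : x < y := (Nat.pow_lt_pow_iff_right (by omega)).1 h
  calc 2 * p ^ x ≤ p * p ^ x := Nat.mul_le_mul_right _ hp
    _ = p ^ (x + 1) := (pow_succ' p x).symm
    _ ≤ p ^ y := Nat.pow_le_pow_right (by omega) hxy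

/-- At most three of seven consecutive terms of an arithmetic progression lie in a fixed translate
of the set of powers of `p`. -/
theorem card_le_three_of_translate_pow {a d c p : ℕ} (hp : 2 ≤ p) (hd : 0 < d) {s : Finset ℕ}
    (hs : ∀ i ∈ s, i ≤ 6 ∧ ∃ y, a + i * d = c + p ^ y) : s.card ≤ 3 := by
  by_contra! hcard
  obtain ⟨t, hts, ht⟩ := Finset.exists_subset_card_eq (show 4 ≤ s.card from hcard)
  let f := t.orderEmbOfFin ht
  have hf (k : Fin 4) : f k ≤ 6 ∧ ∃ y, a + f k * d = c + p ^ y :=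
    hs _ (hts (t.orderEmbOfFin_mem ht k))
  have h₀₁ : f 0 < f 1 := f.strictMono (by decide)
  have h₁₂ : f 1 < f 2 := f.strictMono (by decide)
  have h₂₃ : f 2 < f 3 := f.strictMono (by decide)
  obtain ⟨-, y₀, e₀⟩ := hf 0
  obtain ⟨-, y₁, e₁⟩ := hf 1
  obtain ⟨-, y₂, e₂⟩ := hf 2
  obtain ⟨h₃, y₃, e₃⟩ := hf 3
  generalize f 0 = i₀ at *
  generalize f 1 = i₁ at *
  generalize f 2 = i₂ at *
  generalize f 3 = i₃ at *
  have m₀₁ := Nat.mul_lt_mul_of_pos_right h₀₁ hd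
  have m₁₂ := Nat.mul_lt_mul_of_pos_right h₁₂ hd
  have m₂₃ := Nat.mul_lt_mul_of_pos_right h₂₃ hd
  have p₁₂ := two_mul_pow_le_pow_of_lt hp (show p ^ y₁ < p ^ y₂ by omega)
  have p₂₃ := two_mul_pow_le_pow_of_lt hp (show p ^ y₂ < p ^ y₃ by omega)
  have hpos : 0 < p ^ y₀ := Nat.pow_pos (by omega)
  have gap₁ : i₁ + i₁ < i₂ + i₀ := by
    refine Nat.lt_of_mul_lt_mul_right (a := d) ?_
    rw [add_mul, add_mul]
    omega
  have gap₂ : i₂ + i₂ < i₃ + i₀ := by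
    refine Nat.lt_of_mul_lt_mul_right (a := d) ?_
    rw [add_mul, add_mul]
    omega
  omega

/-- If two of seven consecutive terms of an arithmetic progression lie in `c` plus the powers of
`p`, then `c` is close to the progression. -/
theorem translate_near_of_one_lt_card {a d c p : ℕ} (hp : 2 ≤ p) (hd : 0 < d) {s : Finset ℕ}
    (hs : ∀ i ∈ s, i ≤ 6 ∧ ∃ y, a + i * d = c + p ^ y) (hcard : 1 < s.card) :
    a ≤ c + 6 * d := by
  obtain ⟨i, hi, j, hj, hij⟩ := Finset.one_lt_card.1 hcard
  wlog hlt : i < j generalizing i j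
  · exact this j hj i hi hij.symm (by omega)
  obtain ⟨-, x, hx⟩ := hs i hi
  obtain ⟨hj6, y, hy⟩ := hs j hj
  have hm := Nat.mul_lt_mul_of_pos_right hlt hd
  have hxy := two_mul_pow_le_pow_of_lt hp (show p ^ x < p ^ y by omega)
  have := Nat.mul_le_mul_right d hj6
  omega

/-- Under the standing hypotheses, the common difference satisfies d ≥ 500. -/
theorem d_ge_500 (a d m n : ℕ)
    (ha : 0 < a) (hd : 0 < d)
    (hAP : ∀ i : ℕ, i ≤ 6 → ∃ x y : ℕ, a + i * d = 3 ^ x + 2 ^ y)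
    (hbig : 3 ^ 9 ≤ a + 6 * d)
    (hm₁ : 3 ^ m ≤ a + 6 * d) (hm₂ : a + 6 * d < 3 ^ (m + 1))
    (hn₁ : 2 ^ n ≤ a + 6 * d) (hn₂ : a + 6 * d < 2 ^ (n + 1)) :
    500 ≤ d := by
  classical
  by_contra! hd500
  have hn : 14 ≤ n := by
    by_contra! h
    have : 2 ^ (n + 1) ≤ 2 ^ 14 := Nat.pow_le_pow_right (by norm_num) (by omega)
    omega
  obtain ⟨k, rfl⟩ : ∃ k, n = k + 1 := ⟨n - 1, by omega⟩
  have hk : 2 ^ 13 ≤ 2 ^ k := Nat.pow_le_pow_right (by norm_num) (by omega)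
  have hk' : 2 ^ (k + 1) = 2 * 2 ^ k := pow_succ' 2 k
  have hle {i x y : ℕ} (hi : i ≤ 6) (h : a + i * d = 3 ^ x + 2 ^ y) : x ≤ m ∧ y ≤ k + 1 := by
    have := Nat.mul_le_mul_right d hi
    have h3_pos : 0 < 3 ^ x := by positivity
    have h2_pos : 0 < 2 ^ y := by positivity
    have h3 : 3 ^ x < 3 ^ (m + 1) := by omega
    have h2 : 2 ^ y < 2 ^ (k + 1 + 1) := by omega
    rw [Nat.pow_lt_pow_iff_right (by norm_num)] at h3 h2
    omega
  have hthree {x : ℕ} (hx : x < m) : 3 * 3 ^ x ≤ 3 ^ m := by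
    rw [← pow_succ']
    exact Nat.pow_le_pow_right (by norm_num) hx
  let A := {i ∈ Finset.range 7 | ∃ y, a + i * d = 3 ^ m + 2 ^ y}
  let B := {i ∈ Finset.range 7 | ∃ x, a + i * d = 2 ^ (k + 1) + 3 ^ x}
  let C := {i ∈ Finset.range 7 | ∃ x, a + i * d = 2 ^ k + 3 ^ x}
  have hA : ∀ i ∈ A, i ≤ 6 ∧ ∃ y, a + i * d = 3 ^ m + 2 ^ y := fun i hi => by
    obtain ⟨h, h'⟩ := Finset.mem_filter.1 hi
    exact ⟨Nat.lt_succ_iff.1 (Finset.mem_range.1 h), h'⟩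
  have hB : ∀ i ∈ B, i ≤ 6 ∧ ∃ x, a + i * d = 2 ^ (k + 1) + 3 ^ x := fun i hi => by
    obtain ⟨h, h'⟩ := Finset.mem_filter.1 hi
    exact ⟨Nat.lt_succ_iff.1 (Finset.mem_range.1 h), h'⟩
  have hC : ∀ i ∈ C, i ≤ 6 ∧ ∃ x, a + i * d = 2 ^ k + 3 ^ x := fun i hi => by
    obtain ⟨h, h'⟩ := Finset.mem_filter.1 hi
    exact ⟨Nat.lt_succ_iff.1 (Finset.mem_range.1 h), h'⟩
  have hcover : Finset.range 7 ⊆ A ∪ B ∪ C := by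
    intro i hi
    have hi6 : i ≤ 6 := Nat.lt_succ_iff.1 (Finset.mem_range.1 hi)
    obtain ⟨x, y, h⟩ := hAP i hi6
    obtain ⟨hx, hy⟩ := hle hi6 h
    simp only [Finset.mem_union, A, B, C, Finset.mem_filter, hi, true_and]
    rcases hx.eq_or_lt with rfl | hx
    · exact Or.inl (Or.inl ⟨y, h⟩)
    rcases hy.eq_or_lt with rfl | hy
    · exact Or.inl (Or.inr ⟨x, by omega⟩)
    rcases (Nat.lt_succ_iff.1 hy).eq_or_lt with rfl | hy
    · exact Or.inr ⟨x, by omega⟩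
    have h3 := hthree hx
    have h2 : 2 * 2 ^ y ≤ 2 ^ k := by
      rw [← pow_succ']
      exact Nat.pow_le_pow_right (by norm_num) hy
    omega
  have hcard : 7 ≤ A.card + B.card + C.card := by
    calc 7 = (Finset.range 7).card := (Finset.card_range 7).symm
      _ ≤ (A ∪ B ∪ C).card := Finset.card_le_card hcover
      _ ≤ (A ∪ B).card + C.card := Finset.card_union_le _ _
      _ ≤ A.card + B.card + C.card := Nat.add_le_add_right (Finset.card_union_le _ _) _
  have hA3 := card_le_three_of_translate_pow le_rfl hd hA
  have hB3 := card_le_three_of_translate_pow (by norm_num) hd hB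
  have hC1 : C.card ≤ 1 := by
    by_contra! h
    have := translate_near_of_one_lt_card (by norm_num) hd hC h
    omega
  have hA_near := translate_near_of_one_lt_card le_rfl hd hA (by omega)
  obtain ⟨i, hi⟩ := Finset.card_pos.1 (show 0 < C.card by omega)
  obtain ⟨hi6, x, h⟩ := hC i hi
  have := Nat.mul_le_mul_right d hi6
  rcases (hle hi6 (h.trans (add_comm _ _))).1.eq_or_lt with rfl | hx
  · omega
  · have := hthree hx
    omega
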